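/- Let C be a small, finitely complete category admitting pushouts of Mal'cev spans. Then C is diexact if and only if there exists a fully faithful functor from C into a Grothendieck topos (a category of sheaves of sets on a small site) preserving finite limits and pushouts of Mal'cev spans. -/

import Mathlib

open CategoryTheory CategoryTheory.Limits

universe v u

section Defs

variable {C : Type u} [Category.{v} C]

/-- A span `(f, g)` is *jointly monic* if `u ≫ f = v ≫ f` and `u ≫ g = v ≫ g` imply `u = v`
(equivalently, the induced map into the product is a monomorphism). -/
def JointlyMonic {Z A B : C} (f : Z ⟶ A) (g : Z ⟶ B) : Prop :=
  ∀ ⦃X : C⦄ (u v : X ⟶ Z), u ≫ f = v ≫ f → u ≫ g = v ≫ g → u = v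

/-- `(P, π₁, π₂, π₃)` is the limit `C ×_B C ×_A C` of triples `(c₁, c₂, c₃)` of generalized
elements of `Z` with `g ∘ π₁ = g ∘ π₂` and `f ∘ π₂ = f ∘ π₃`. -/
structure IsTripleLimit {Z A B : C} (f : Z ⟶ A) (g : Z ⟶ B) {P : C}
    (π₁ π₂ π₃ : P ⟶ Z) : Prop where
  w₁ : π₁ ≫ g = π₂ ≫ g
  w₂ : π₂ ≫ f = π₃ ≫ f
  lift : ∀ ⦃X : C⦄ (x₁ x₂ x₃ : X ⟶ Z), x₁ ≫ g = x₂ ≫ g → x₂ ≫ f = x₃ ≫ f →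
    ∃! u : X ⟶ P, u ≫ π₁ = x₁ ∧ u ≫ π₂ = x₂ ∧ u ≫ π₃ = x₃

/-- A jointly monic span `(f, g)` is a *Mal'cev span* if, for the limit
`P = C ×_B C ×_A C`, there exists `p : P ⟶ C` with `f ∘ p = f ∘ π₁` and `g ∘ p = g ∘ π₃`. -/
def IsMalcevSpan {Z A B : C} (f : Z ⟶ A) (g : Z ⟶ B) : Prop :=
  JointlyMonic f g ∧
  ∀ ⦃P : C⦄ (π₁ π₂ π₃ : P ⟶ Z), IsTripleLimit f g π₁ π₂ π₃ →
    ∃ p : P ⟶ Z, p ≫ f = π₁ ≫ f ∧ p ≫ g = π₃ ≫ g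

/-- A commuting square (with legs `f, g` and colegs `h, k`) is *stable under pullback* if
every commutative cube over it whose four side faces are pullbacks has a pushout top face. -/
def PushoutStable {Z A B D : C} (f : Z ⟶ A) (g : Z ⟶ B) (h : A ⟶ D) (k : B ⟶ D) : Prop :=
  ∀ ⦃Z' A' B' D' : C⦄ (f' : Z' ⟶ A') (g' : Z' ⟶ B') (h' : A' ⟶ D') (k' : B' ⟶ D')
    (αZ : Z' ⟶ Z) (αA : A' ⟶ A) (αB : B' ⟶ B) (αD : D' ⟶ D),
    IsPullback f' αZ αA f → IsPullback g' αZ αB g →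
    IsPullback h' αA αD h → IsPullback k' αB αD k →
    f' ≫ h' = g' ≫ k' → IsPushout f' g' h' k'

/-- A category is *diexact* if every Mal'cev span admits a pushout, and every pushout square
of a Mal'cev span is stable under pullback and is itself a pullback square. -/
def Diexact (C : Type u) [Category.{v} C] : Prop :=
  ∀ ⦃Z A B : C⦄ (f : Z ⟶ A) (g : Z ⟶ B), IsMalcevSpan f g →
    (∃ (D : C) (h : A ⟶ D) (k : B ⟶ D), IsPushout f g h k) ∧
    ∀ ⦃D : C⦄ (h : A ⟶ D) (k : B ⟶ D), IsPushout f g h k →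
      PushoutStable f g h k ∧ IsPullback f g h k

/-- An internal equivalence relation: a jointly monic pair which is reflexive, symmetric
and transitive. -/
def IsEquivRelation [HasPullbacks C] {E A : C} (s t : E ⟶ A) : Prop :=
  JointlyMonic s t ∧
  (∃ r : A ⟶ E, r ≫ s = 𝟙 A ∧ r ≫ t = 𝟙 A) ∧
  (∃ σ : E ⟶ E, σ ≫ s = t ∧ σ ≫ t = s) ∧
  (∃ τ : pullback t s ⟶ E,
     τ ≫ s = pullback.fst t s ≫ s ∧ τ ≫ t = pullback.snd t s ≫ t)

/-- A finitely complete category is *Barr-exact* if every kernel pair has a coequaliser,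
regular epimorphisms are stable under pullback, and every internal equivalence relation is
effective (i.e. a kernel pair). -/
def BarrExact (C : Type u) [Category.{v} C] [HasFiniteLimits C] : Prop :=
  (∀ ⦃X Y : C⦄ (f : X ⟶ Y), HasCoequalizer (pullback.fst f f) (pullback.snd f f)) ∧
  (∀ ⦃X Y W : C⦄ (f : X ⟶ Y) (g : W ⟶ Y),
     Nonempty (RegularEpi f) → Nonempty (RegularEpi (pullback.snd f g))) ∧
  (∀ ⦃E A : C⦄ (s t : E ⟶ A), IsEquivRelation s t →
     ∃ (Q : C) (q : A ⟶ Q), IsPullback s t q q)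

/-- A category is *amalgamable* if every span of monomorphisms admits a pushout which is
stable under pullback and is itself a pullback square. -/
def Amalgamable (C : Type u) [Category.{v} C] : Prop :=
  ∀ ⦃Z A B : C⦄ (f : Z ⟶ A) (g : Z ⟶ B), Mono f → Mono g →
    ∃ (D : C) (h : A ⟶ D) (k : B ⟶ D),
      IsPushout f g h k ∧ PushoutStable f g h k ∧ IsPullback f g h k

/-- A category is *adhesive* if it admits pushouts along monomorphisms, and these pushouts
are stable under pullback and are pullback squares. -/
def AdhesiveCat (C : Type u) [Category.{v} C] : Prop :=
  ∀ ⦃Z A B : C⦄ (f : Z ⟶ A) (g : Z ⟶ B), Mono f →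
    (∃ (D : C) (h : A ⟶ D) (k : B ⟶ D), IsPushout f g h k) ∧
    ∀ ⦃D : C⦄ (h : A ⟶ D) (k : B ⟶ D), IsPushout f g h k →
      PushoutStable f g h k ∧ IsPullback f g h k

/-- `u` factors through `v` (as morphisms into a common object `X`). -/
def FactorsThru {U V X : C} (u : U ⟶ X) (v : V ⟶ X) : Prop :=
  ∃ w : U ⟶ V, w ≫ v = u

/-- A monomorphism `m : P ⟶ X` is the *union* of the subobjects `a : A ⟶ X` and `b : B ⟶ X`:
both factor through `m`, and `m` factors through any monomorphism through which both factor. -/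
def IsUnionOf {A B P X : C} (a : A ⟶ X) (b : B ⟶ X) (m : P ⟶ X) : Prop :=
  Mono m ∧ FactorsThru a m ∧ FactorsThru b m ∧
  ∀ ⦃Q : C⦄ (c : Q ⟶ X), Mono c → FactorsThru a c → FactorsThru b c → FactorsThru m c

end Defs
section Embedding

variable {C : Type u} [Category.{v} C]

theorem JointlyMonic.symm {Z A B : C} {f : Z ⟶ A} {g : Z ⟶ B} (h : JointlyMonic f g) :
    JointlyMonic g f :=
  fun _ u v h₁ h₂ => h u v h₂ h₁

/-- The Mal'cev condition in terms of generalized elements. -/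
theorem isMalcevSpan_iff [HasPullbacks C] {Z A B : C} {f : Z ⟶ A} {g : Z ⟶ B} :
    IsMalcevSpan f g ↔ JointlyMonic f g ∧
      ∀ ⦃X : C⦄ (x₁ x₂ x₃ : X ⟶ Z), x₁ ≫ g = x₂ ≫ g → x₂ ≫ f = x₃ ≫ f →
        ∃ p : X ⟶ Z, p ≫ f = x₁ ≫ f ∧ p ≫ g = x₃ ≫ g := by
  refine ⟨fun ⟨hm, hp⟩ => ⟨hm, fun X x₁ x₂ x₃ h₁ h₂ => ?_⟩,
    fun ⟨hm, hp⟩ => ⟨hm, fun P π₁ π₂ π₃ hl => hp _ _ _ hl.w₁ hl.w₂⟩⟩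
  let a := pullback.fst (pullback.snd g g ≫ f) f
  have hl : IsTripleLimit f g (a ≫ pullback.fst g g) (a ≫ pullback.snd g g)
      (pullback.snd (pullback.snd g g ≫ f) f) := by
    refine ⟨by simp [pullback.condition], by simp [a, pullback.condition],
      fun Y y₁ y₂ y₃ e₁ e₂ => ?_⟩
    refine ⟨pullback.lift (pullback.lift y₁ y₂ e₁) y₃
        (by simpa only [pullback.lift_snd_assoc] using e₂),
      by simp [a, pullback.lift_fst, pullback.lift_snd, pullback.lift_fst_assoc],
      fun u hu => ?_⟩
    obtain ⟨rfl, rfl, rfl⟩ := hu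
    apply pullback.hom_ext
    · apply pullback.hom_ext <;> simp [a, pullback.lift_fst, pullback.lift_snd]
    · simp [pullback.lift_snd]
  obtain ⟨p, hp₁, hp₂⟩ := hp _ _ _ hl
  obtain ⟨u, ⟨rfl, rfl, rfl⟩, -⟩ := hl.lift x₁ x₂ x₃ h₁ h₂
  exact ⟨u ≫ p, by simp [hp₁], by simp [hp₂]⟩

theorem IsMalcevSpan.symm [HasPullbacks C] {Z A B : C} {f : Z ⟶ A} {g : Z ⟶ B}
    (h : IsMalcevSpan f g) : IsMalcevSpan g f := by
  rw [isMalcevSpan_iff] at h ⊢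
  refine ⟨h.1.symm, fun X x₁ x₂ x₃ h₁ h₂ => ?_⟩
  obtain ⟨p, hp₁, hp₂⟩ := h.2 x₃ x₂ x₁ h₂.symm h₁.symm
  exact ⟨p, hp₂, hp₁⟩

theorem isMalcevSpan_of_mono [HasPullbacks C] {Z A B : C} (f : Z ⟶ A) (g : Z ⟶ B) [Mono f] :
    IsMalcevSpan f g := by
  rw [isMalcevSpan_iff]
  refine ⟨fun X u v h _ => (cancel_mono f).1 h, fun X x₁ x₂ x₃ h₁ h₂ => ?_⟩
  obtain rfl := (cancel_mono f).1 h₂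
  exact ⟨x₁, rfl, h₁⟩

theorem isMalcevSpan_of_kernelPair [HasPullbacks C] {Z A B : C} {p q : Z ⟶ A} {w : A ⟶ B}
    (h : IsPullback p q w w) : IsMalcevSpan p q := by
  rw [isMalcevSpan_iff]
  refine ⟨fun X u v h₁ h₂ => h.hom_ext h₁ h₂, fun X x₁ x₂ x₃ h₁ h₂ => ?_⟩
  refine ⟨h.lift (x₁ ≫ p) (x₃ ≫ q) ?_, h.lift_fst _ _ _, h.lift_snd _ _ _⟩
  simp only [Category.assoc]
  rw [h.w, reassoc_of% h₁, ← h.w, reassoc_of% h₂, h.w]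

/-- A Mal'cev span over `D` pulls back along any `m : T ⟶ D` to a Mal'cev span over `T`. -/
theorem IsMalcevSpan.exists_pullback [HasPullbacks C] {Z A B D T : C} {f : Z ⟶ A} {g : Z ⟶ B}
    (hfg : IsMalcevSpan f g) {h : A ⟶ D} {k : B ⟶ D} (w : f ≫ h = g ≫ k) (m : T ⟶ D) :
    ∃ (Z' A' B' : C) (f' : Z' ⟶ A') (g' : Z' ⟶ B') (h' : A' ⟶ T) (k' : B' ⟶ T)
      (αZ : Z' ⟶ Z) (αA : A' ⟶ A) (αB : B' ⟶ B),
      IsPullback f' αZ αA f ∧ IsPullback g' αZ αB g ∧ IsPullback h' αA m h ∧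
      IsPullback k' αB m k ∧ f' ≫ h' = g' ≫ k' ∧ IsMalcevSpan f' g' := by
  have hA := IsPullback.of_hasPullback m h
  have hB := IsPullback.of_hasPullback m k
  have hZ := IsPullback.of_hasPullback m (f ≫ h)
  have e₁ : pullback.fst m (f ≫ h) ≫ m = (pullback.snd m (f ≫ h) ≫ f) ≫ h := by
    simp [pullback.condition]
  have e₂ : pullback.fst m (f ≫ h) ≫ m = (pullback.snd m (f ≫ h) ≫ g) ≫ k := by
    simp [pullback.condition, w]
  let f' : pullback m (f ≫ h) ⟶ pullback m h := pullback.lift _ _ e₁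
  let g' : pullback m (f ≫ h) ⟶ pullback m k := pullback.lift _ _ e₂
  have hf : IsPullback f' (pullback.snd m (f ≫ h)) (pullback.snd m h) f := by
    refine (IsPullback.of_bot (v₂₁ := pullback.fst m h) (h₃₁ := m) ?_ ?_ hA.flip).flip
    · simpa [f', pullback.lift_fst] using hZ.flip
    · simp [f', pullback.lift_snd]
  have hg : IsPullback g' (pullback.snd m (f ≫ h)) (pullback.snd m k) g := by
    refine (IsPullback.of_bot (v₂₁ := pullback.fst m k) (h₃₁ := m) ?_ ?_ hB.flip).flip
    · simpa [g', w, pullback.lift_fst] using hZ.flip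
    · simp [g', pullback.lift_snd]
  refine ⟨_, _, _, f', g', pullback.fst m h, pullback.fst m k, _, _, _, hf, hg, hA, hB,
    by simp [f', g', pullback.lift_fst], ?_⟩
  rw [isMalcevSpan_iff] at hfg ⊢
  refine ⟨fun X u v h₁ h₂ => hf.hom_ext h₁ (hfg.1 _ _ ?_ ?_), fun X x₁ x₂ x₃ h₁ h₂ => ?_⟩
  · simpa [hf.w] using congr($h₁ ≫ pullback.snd m h)
  · simpa [hg.w] using congr($h₂ ≫ pullback.snd m k)
  · obtain ⟨p, hp₁, hp₂⟩ := hfg.2 (x₁ ≫ pullback.snd m (f ≫ h)) (x₂ ≫ pullback.snd m (f ≫ h))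
      (x₃ ≫ pullback.snd m (f ≫ h)) (by simpa [hg.w] using congr($h₁ ≫ pullback.snd m k))
      (by simpa [hf.w] using congr($h₂ ≫ pullback.snd m h))
    have e₃ : x₁ ≫ pullback.fst m (f ≫ h) = x₃ ≫ pullback.fst m (f ≫ h) := by
      have i₁ := congr($h₁ ≫ pullback.fst m k)
      have i₂ := congr($h₂ ≫ pullback.fst m h)
      simp only [f', g', Category.assoc, pullback.lift_fst] at i₁ i₂
      exact i₁.trans i₂
    refine ⟨hf.lift (x₁ ≫ f') p (by simp [hp₁, hf.w]), by simp, ?_⟩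
    apply pullback.hom_ext
    · have : g' ≫ pullback.fst m k = f' ≫ pullback.fst m h := by
        simp [f', g', pullback.lift_fst]
      simp only [Category.assoc, this, hf.lift_fst_assoc]
      simp [f', pullback.lift_fst, e₃]
    · simp [hp₂, hg.w]

/-- The sieve of morphisms factoring through `h` or through `k`. -/
def pairSieve {A B D : C} (h : A ⟶ D) (k : B ⟶ D) : Sieve D where
  arrows _ x := FactorsThru x h ∨ FactorsThru x k
  downward_closed := by
    rintro X Y x (⟨w, rfl⟩ | ⟨w, rfl⟩) y
    · exact Or.inl ⟨y ≫ w, by simp⟩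
    · exact Or.inr ⟨y ≫ w, by simp⟩

theorem pairSieve_left {A B D : C} (h : A ⟶ D) (k : B ⟶ D) : pairSieve h k h :=
  Or.inl ⟨𝟙 _, by simp⟩

theorem pairSieve_right {A B D : C} (h : A ⟶ D) (k : B ⟶ D) : pairSieve h k k :=
  Or.inr ⟨𝟙 _, by simp⟩

theorem Diexact.pairSieve_mem [HasPullbacks C] (hC : Diexact C) {Z A B D : C} {f : Z ⟶ A}
    {g : Z ⟶ B} {h : A ⟶ D} {k : B ⟶ D} (hfg : IsMalcevSpan f g) (sq : IsPushout f g h k) :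
    pairSieve h k ∈ Sheaf.canonicalTopology C D := by
  apply Sheaf.mem_finestTopology_of_forall_isSheafFor
  rintro _ ⟨X, rfl⟩ T m
  obtain ⟨Z', A', B', f', g', h', k', αZ, αA, αB, hf, hg, hh, hk, w, -⟩ :=
    hfg.exists_pullback sq.w m
  have sq' : IsPushout f' g' h' k' := ((hC f g hfg).2 h k sq).1 _ _ _ _ _ _ _ _ hf hg hh hk w
  have mh : (pairSieve h k).pullback m h' := Or.inl ⟨αA, hh.w.symm⟩
  have mk : (pairSieve h k).pullback m k' := Or.inr ⟨αB, hk.w.symm⟩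
  have key : ∀ ⦃Y⦄ (y : Y ⟶ T), (pairSieve h k).pullback m y → pairSieve h' k' y := by
    rintro Y y (⟨t, ht⟩ | ⟨t, ht⟩)
    · exact Or.inl ⟨hh.lift y t ht.symm, by simp⟩
    · exact Or.inr ⟨hk.lift y t ht.symm, by simp⟩
  intro x hx
  refine ⟨sq'.desc (x h' mh) (x k' mk) (hx f' g' mh mk w), fun Y y hy => ?_, fun t ht => ?_⟩
  · obtain ⟨t, rfl⟩ | ⟨t, rfl⟩ := key y hy
    · have := hx t (𝟙 _) mh hy (by simp)
      simp at this ⊢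
      exact this
    · have := hx t (𝟙 _) mk hy (by simp)
      simp at this ⊢
      exact this
  · apply sq'.hom_ext
    · simpa using ht h' mh
    · simpa using ht k' mk

/-- Equality of morphisms may be checked locally for the canonical topology. -/
theorem hom_ext_of_mem_canonicalTopology {X Y : C} {S : Sieve X}
    (hS : S ∈ Sheaf.canonicalTopology C X) {u v : X ⟶ Y}
    (h : ∀ ⦃T⦄ (x : T ⟶ X), S x → x ≫ u = x ≫ v) : u = v :=
  (Sheaf.isSheaf_yoneda_obj Y S hS).isSeparatedFor.ext fun _ _ hx => h _ hx

theorem Diexact.exists_section_of_mono [HasPullbacks C] (hC : Diexact C) {Z A B D S : C}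
    {f : Z ⟶ A} {g : Z ⟶ B} {h : A ⟶ D} {k : B ⟶ D} (sq : IsPushout f g h k)
    (s : S ⟶ A) [Mono s] (f₀ : Z ⟶ S) (hf₀ : f₀ ≫ s = f) (a : D ⟶ S)
    (ha : a ≫ s ≫ h = 𝟙 D) : ∃ t : A ⟶ S, t ≫ s = 𝟙 A := by
  obtain ⟨⟨V, i, j, hV⟩, hV'⟩ := hC s (s ≫ h) (isMalcevSpan_of_mono s _)
  have hfi : f ≫ i = g ≫ k ≫ j := by
    rw [← reassoc_of% sq.w, ← hf₀, Category.assoc, hV.w]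
    simp
  let φ := sq.desc i (k ≫ j) hfi
  have hi : h ≫ φ = i := by simp [φ]
  have hφ : φ = j := by
    have : φ = (a ≫ s ≫ h) ≫ φ := by simp [ha]
    rw [this, Category.assoc, Category.assoc, hi, hV.w, Category.assoc, reassoc_of% ha]
  exact ⟨(hV' i j hV).2.lift (𝟙 A) h (by rw [← hi, hφ]; simp), by simp⟩

theorem Diexact.pairSieve_section_mem [HasPullbacks C] (hC : Diexact C) {Z A B D : C}
    {f : Z ⟶ A} {g : Z ⟶ B} {h : A ⟶ D} {k : B ⟶ D} (sq : IsPushout f g h k)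
    (a : D ⟶ A) (ha : a ≫ h = 𝟙 D) : pairSieve a f ∈ Sheaf.canonicalTopology C A := by
  let J := Sheaf.canonicalTopology C
  have : Mono a := (SplitMono.mk h ha).mono
  have hP := (isMalcevSpan_of_mono (pullback.snd a f) (pullback.fst a f)).symm
  obtain ⟨⟨W₀, j, i, hW₀⟩, -⟩ := hC _ _ hP
  have hcov₀ := hC.pairSieve_mem hP hW₀
  let w : W₀ ⟶ A := hW₀.desc a f pullback.condition
  have hja : j ≫ w = a := by simp [w]
  have hif : i ≫ w = f := by simp [w]
  have hK := IsPullback.of_hasPullback w w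
  obtain ⟨⟨W, q, q', hW⟩, -⟩ := hC _ _ (isMalcevSpan_of_kernelPair hK)
  have hcov := hC.pairSieve_mem (isMalcevSpan_of_kernelPair hK) hW
  obtain rfl : q = q' := by
    simpa using congr(pullback.diagonal w ≫ $hW.w)
  let s : W ⟶ A := hW.desc w w hK.w
  have hqs : q ≫ s = w := by simp [s]
  have hq : ∀ ⦃T⦄ (x : T ⟶ W), pairSieve q q x → ∃ y, y ≫ q = x := by
    rintro T x (⟨y, hy⟩ | ⟨y, hy⟩) <;> exact ⟨y, hy⟩
  have : Mono s := by
    refine ⟨fun {X} u v huv => hom_ext_of_mem_canonicalTopology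
      (J.intersection_covering (J.pullback_stable u hcov) (J.pullback_stable v hcov)) ?_⟩
    rintro T x ⟨hxu, hxv⟩
    obtain ⟨y, hy⟩ := hq _ hxu
    obtain ⟨y', hy'⟩ := hq _ hxv
    have e : y ≫ w = y' ≫ w := by
      rw [← hqs, reassoc_of% hy, reassoc_of% hy', huv]
    rw [← hy, ← hy']
    simpa [pullback.lift_fst_assoc, pullback.lift_snd_assoc] using
      congr(pullback.lift y y' e ≫ $hW.w)
  obtain ⟨t, ht⟩ := hC.exists_section_of_mono sq s (i ≫ q) (by simp [hqs, hif]) (j ≫ q)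
    (by rw [Category.assoc, reassoc_of% hqs, reassoc_of% hja, ha])
  refine J.transitive (J.pullback_stable t hcov) _ fun X x hx => ?_
  obtain ⟨y, hy⟩ := hq _ hx
  refine J.superset_covering ?_ (J.pullback_stable y hcov₀)
  have hx : x = y ≫ w := by rw [← hqs, reassoc_of% hy, ht, Category.comp_id]
  rintro T z (⟨c, hc⟩ | ⟨c, hc⟩)
  · exact Or.inl ⟨c, by rw [← hja, reassoc_of% hc, hx]⟩
  · exact Or.inr ⟨c, by rw [← hif, reassoc_of% hc, hx]⟩

/-- In a Mal'cev pushout, two elements of `A` with the same image in the pushout are locally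
equal or locally come from `B`. -/
theorem Diexact.exists_covering_of_comp_eq [HasPullbacks C] (hC : Diexact C) {Z A B D : C}
    {f : Z ⟶ A} {g : Z ⟶ B} {h : A ⟶ D} {k : B ⟶ D} (hfg : IsMalcevSpan f g)
    (sq : IsPushout f g h k) {T : C} (u v : T ⟶ A) (huv : u ≫ h = v ≫ h) :
    ∃ S ∈ Sheaf.canonicalTopology C T, ∀ ⦃X⦄ (x : X ⟶ T), S x →
      x ≫ u = x ≫ v ∨ ∃ c : X ⟶ B, c ≫ k = x ≫ u ≫ h := by
  obtain ⟨Z', A', B', f', g', h', k', αZ, αA, αB, hf, hg, hh, hk, w, -⟩ :=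
    hfg.exists_pullback sq.w (u ≫ h)
  have sq' : IsPushout f' g' h' k' := ((hC f g hfg).2 h k sq).1 _ _ _ _ _ _ _ _ hf hg hh hk w
  refine ⟨_, (Sheaf.canonicalTopology C).pullback_stable (hh.lift (𝟙 T) v (by simp [huv]))
    (hC.pairSieve_section_mem sq' (hh.lift (𝟙 T) u (by simp)) (by simp)), ?_⟩
  rintro X x (⟨y, hy⟩ | ⟨y, hy⟩)
  · left
    have e₁ := congr($hy ≫ h')
    have e₂ := congr($hy ≫ αA)
    simp only [Category.assoc, IsPullback.lift_fst, IsPullback.lift_snd, Category.comp_id]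
      at e₁ e₂
    rw [← e₂, e₁]
  · right
    refine ⟨y ≫ g' ≫ αB, ?_⟩
    rw [Category.assoc, Category.assoc, ← hk.w, ← reassoc_of% w, reassoc_of% hy]
    simp

open Opposite

theorem map_eq_map_of_isPullback {Z A B D : C} {f : Z ⟶ A} {g : Z ⟶ B} {h : A ⟶ D}
    {k : B ⟶ D} (hpb : IsPullback f g h k) {P : Cᵒᵖ ⥤ Type*} {a : P.obj (op A)} {b : P.obj (op B)}
    (hab : P.map f.op a = P.map g.op b) {X : C} {u : X ⟶ A} {v : X ⟶ B} (e : u ≫ h = v ≫ k) :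
    P.map u.op a = P.map v.op b := by
  obtain ⟨l, rfl, rfl⟩ := hpb.exists_lift u v e
  simp [hab]

theorem Diexact.map_eq_map_of_isSheaf [HasPullbacks C] (hC : Diexact C) {Z A B D : C}
    {f : Z ⟶ A} {g : Z ⟶ B} {h : A ⟶ D} {k : B ⟶ D} (hfg : IsMalcevSpan f g)
    (sq : IsPushout f g h k) {P : Cᵒᵖ ⥤ Type*}
    (hP : Presieve.IsSheaf (Sheaf.canonicalTopology C) P) {a : P.obj (op A)} {b : P.obj (op B)}
    (hab : P.map f.op a = P.map g.op b) {T : C} (u v : T ⟶ A) (huv : u ≫ h = v ≫ h) :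
    P.map u.op a = P.map v.op a := by
  have hpb := ((hC f g hfg).2 h k sq).2
  obtain ⟨S, hS, hS'⟩ := hC.exists_covering_of_comp_eq hfg sq u v huv
  refine (hP S hS).isSeparatedFor.ext fun X x hx => ?_
  rw [← Functor.map_comp_apply, ← Functor.map_comp_apply, ← op_comp, ← op_comp]
  obtain e | ⟨c, hc⟩ := hS' x hx
  · rw [e]
  · rw [map_eq_map_of_isPullback hpb hab (u := x ≫ u) (v := c)
        (by simpa using hc.symm),
      map_eq_map_of_isPullback hpb hab (u := x ≫ v) (v := c)
        (by simpa [← huv] using hc.symm)]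

/-- Sheaves for the canonical topology of a diexact category send pushouts of Mal'cev spans to
pullbacks. -/
theorem Diexact.existsUnique_of_isSheaf [HasPullbacks C] (hC : Diexact C) {Z A B D : C}
    {f : Z ⟶ A} {g : Z ⟶ B} {h : A ⟶ D} {k : B ⟶ D} (hfg : IsMalcevSpan f g)
    (sq : IsPushout f g h k) {P : Cᵒᵖ ⥤ Type*}
    (hP : Presieve.IsSheaf (Sheaf.canonicalTopology C) P) {a : P.obj (op A)} {b : P.obj (op B)}
    (hab : P.map f.op a = P.map g.op b) :
    ∃! d : P.obj (op D), P.map h.op d = a ∧ P.map k.op d = b := by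
  let R : ∀ ⦃X : C⦄, (X ⟶ D) → P.obj (op X) → Prop := fun X y e =>
    (∃ w : X ⟶ A, w ≫ h = y ∧ P.map w.op a = e) ∨ (∃ w : X ⟶ B, w ≫ k = y ∧ P.map w.op b = e)
  have hR : ∀ ⦃X : C⦄ (y : X ⟶ D) (e e' : P.obj (op X)), R y e → R y e' → e = e' := by
    have hpb := ((hC f g hfg).2 h k sq).2
    rintro X y _ _ (⟨w, hw, rfl⟩ | ⟨w, hw, rfl⟩) (⟨w', hw', rfl⟩ | ⟨w', hw', rfl⟩)
    · exact hC.map_eq_map_of_isSheaf hfg sq hP hab _ _ (hw.trans hw'.symm)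
    · exact map_eq_map_of_isPullback hpb hab (hw.trans hw'.symm)
    · exact (map_eq_map_of_isPullback hpb hab (hw'.trans hw.symm)).symm
    · exact hC.map_eq_map_of_isSheaf hfg.symm sq.flip hP hab.symm _ _ (hw.trans hw'.symm)
  have hR' : ∀ ⦃X Y : C⦄ (x : Y ⟶ X) (y : X ⟶ D) (e : P.obj (op X)), R y e →
      R (x ≫ y) (P.map x.op e) := by
    rintro X Y x y _ (⟨w, rfl, rfl⟩ | ⟨w, rfl, rfl⟩)
    · exact Or.inl ⟨x ≫ w, by simp, by simp⟩
    · exact Or.inr ⟨x ≫ w, by simp, by simp⟩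
  have hex : ∀ ⦃X : C⦄ (y : X ⟶ D), pairSieve h k y → ∃ e, R y e := by
    rintro X y (⟨w, hw⟩ | ⟨w, hw⟩)
    · exact ⟨_, Or.inl ⟨w, hw, rfl⟩⟩
    · exact ⟨_, Or.inr ⟨w, hw, rfl⟩⟩
  choose x hx using hex
  have hcov := hP _ (hC.pairSieve_mem hfg sq)
  have hxh : x h (pairSieve_left h k) = a :=
    hR h _ _ (hx _ _) (Or.inl ⟨𝟙 _, by simp, by simp⟩)
  have hxk : x k (pairSieve_right h k) = b :=
    hR k _ _ (hx _ _) (Or.inr ⟨𝟙 _, by simp, by simp⟩)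
  have hcomp : Presieve.FamilyOfElements.Compatible (P := P) x := by
    intro Y₁ Y₂ W g₁ g₂ f₁ f₂ h₁ h₂ e
    refine hR (g₁ ≫ f₁) _ _ (hR' _ _ _ (hx _ _)) ?_
    rw [e]
    exact hR' _ _ _ (hx _ _)
  obtain ⟨d, hd, -⟩ := hcov x hcomp
  refine ⟨d, ⟨(hd h (pairSieve_left h k)).trans hxh, (hd k (pairSieve_right h k)).trans hxk⟩,
    fun d' hd' => ?_⟩
  refine hcov.isSeparatedFor.ext ?_
  rintro Y _ (⟨w, rfl⟩ | ⟨w, rfl⟩)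
  · simp [hd'.1, hd h (pairSieve_left h k), hxh]
  · simp [hd'.2, hd k (pairSieve_right h k), hxk]

theorem Diexact.isPushout_yoneda [HasPullbacks C] (hC : Diexact C) {Z A B D : C}
    {f : Z ⟶ A} {g : Z ⟶ B} {h : A ⟶ D} {k : B ⟶ D} (hfg : IsMalcevSpan f g)
    (sq : IsPushout f g h k) :
    IsPushout ((Sheaf.canonicalTopology C).yoneda.map f) ((Sheaf.canonicalTopology C).yoneda.map g)
      ((Sheaf.canonicalTopology C).yoneda.map h) ((Sheaf.canonicalTopology C).yoneda.map k) := by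
  let J := Sheaf.canonicalTopology C
  have hex : ∀ (s : PushoutCocone (J.yoneda.map f) (J.yoneda.map g)),
      ∃! d : J.yoneda.obj D ⟶ s.pt, J.yoneda.map h ≫ d = s.inl ∧ J.yoneda.map k ≫ d = s.inr := by
    intro s
    have hP : Presieve.IsSheaf J s.pt.obj := (isSheaf_iff_isSheaf_of_type _ _).1 s.pt.property
    obtain ⟨d, ⟨h₁, h₂⟩, hd⟩ := hC.existsUnique_of_isSheaf hfg sq hP (a := J.yonedaEquiv s.inl)
      (b := J.yonedaEquiv s.inr)
      (by rw [J.yonedaEquiv_naturality, J.yonedaEquiv_naturality, s.condition])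
    obtain ⟨d, rfl⟩ := J.yonedaEquiv.surjective d
    rw [J.yonedaEquiv_naturality] at h₁ h₂
    refine ⟨d, ⟨J.yonedaEquiv.injective h₁, J.yonedaEquiv.injective h₂⟩, fun d' hd' =>
      J.yonedaEquiv.injective (hd _ ?_)⟩
    constructor
    · rw [J.yonedaEquiv_naturality, hd'.1]
    · rw [J.yonedaEquiv_naturality, hd'.2]
  choose d hd hd' using hex
  exact ⟨⟨by rw [← Functor.map_comp, sq.w, Functor.map_comp]⟩,
    ⟨PushoutCocone.IsColimit.mk _ d (fun s => (hd s).1) (fun s => (hd s).2)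
      fun s m h₁ h₂ => hd' s m ⟨h₁, h₂⟩⟩⟩

end Embedding

section Topos

theorem IsMalcevSpan.map {C : Type*} [Category* C] {E : Type*} [Category* E] [HasFiniteLimits C]
    [HasPullbacks E] (F : C ⥤ E) [PreservesFiniteLimits F] {Z A B : C} {f : Z ⟶ A} {g : Z ⟶ B}
    (hfg : IsMalcevSpan f g) : IsMalcevSpan (F.map f) (F.map g) := by
  rw [isMalcevSpan_iff] at hfg ⊢
  refine ⟨fun X u v h₁ h₂ => ?_, fun X x₁ x₂ x₃ h₁ h₂ => ?_⟩
  · have : Mono (prod.lift f g) := ⟨fun u v h => hfg.1 u v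
      (by simpa [prod.lift_fst] using congr($h ≫ prod.fst))
      (by simpa [prod.lift_snd] using congr($h ≫ prod.snd))⟩
    rw [← cancel_mono (F.map (prod.lift f g))]
    apply (isLimitOfHasBinaryProductOfPreservesLimit F A B).hom_ext
    rintro ⟨_ | _⟩
    · simpa [← Functor.map_comp, prod.lift_fst] using h₁
    · simpa [← Functor.map_comp, prod.lift_snd] using h₂
  · let a := pullback.fst (pullback.snd g g ≫ f) f
    have hg := (IsPullback.of_hasPullback g g).map F
    have hf := (IsPullback.of_hasPullback (pullback.snd g g ≫ f) f).map F
    obtain ⟨y, rfl, rfl⟩ := hg.exists_lift x₁ x₂ h₁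
    obtain ⟨z, rfl, rfl⟩ := hf.exists_lift y x₃ (by simpa using h₂)
    obtain ⟨p, hp₁, hp₂⟩ := hfg.2 (a ≫ pullback.fst g g) (a ≫ pullback.snd g g)
      (pullback.snd (pullback.snd g g ≫ f) f) (by simp [pullback.condition])
      (by simp [a, pullback.condition])
    refine ⟨z ≫ F.map p, ?_, ?_⟩
    · simp [a, ← Functor.map_comp, hp₁]
    · simp [← Functor.map_comp, hp₂]

theorem Types.isPullback_of_isMalcevSpan {Z A B D : Type u} {f : Z ⟶ A} {g : Z ⟶ B} {h : A ⟶ D}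
    {k : B ⟶ D} (hfg : IsMalcevSpan f g) (sq : IsPushout f g h k) : IsPullback f g h k := by
  rw [isMalcevSpan_iff] at hfg
  have hp : ∀ z₁ z₂ z₃ : Z, g z₁ = g z₂ → f z₂ = f z₃ → ∃ z, f z = f z₁ ∧ g z = g z₃ := by
    intro z₁ z₂ z₃ h₁ h₂
    obtain ⟨p, hp₁, hp₂⟩ := hfg.2 (X := PUnit.{u + 1}) (↾fun _ => z₁) (↾fun _ => z₂)
      (↾fun _ => z₃) (by ext; exact h₁) (by ext; exact h₂)
    exact ⟨p PUnit.unit, congr($hp₁ PUnit.unit), congr($hp₂ PUnit.unit)⟩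
  rw [Types.isPullback_iff]
  refine ⟨sq.w, fun z z' ⟨h₁, h₂⟩ => ?_, fun a b hab => ?_⟩
  · have := hfg.1 (X := PUnit.{u + 1}) (↾fun _ => z) (↾fun _ => z') (by ext; exact h₁)
      (by ext; exact h₂)
    exact congr($this PUnit.unit)
  · let φ : A ⟶ Set B := ↾fun a => {b | ∃ z, f z = a ∧ g z = b}
    let ψ : B ⟶ Set B := ↾fun b => {b' | b' = b ∨ ∃ z z', g z = b ∧ f z = f z' ∧ g z' = b'}
    have w : f ≫ φ = g ≫ ψ := by
      ext z b
      constructor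
      · rintro ⟨z', h₁, rfl⟩
        exact Or.inr ⟨z, z', rfl, h₁.symm, rfl⟩
      · rintro (rfl | ⟨z₁, z₂, h₁, h₂, rfl⟩)
        · exact ⟨z, rfl, rfl⟩
        · exact hp z z₁ z₂ h₁.symm h₂
    have h₁ : φ a = sq.desc φ ψ w (h a) := congr($(sq.inl_desc φ ψ w) a).symm
    have h₂ : ψ b = sq.desc φ ψ w (k b) := congr($(sq.inr_desc φ ψ w) b).symm
    have : b ∈ φ a := by
      rw [h₁, hab, ← h₂]
      exact Or.inl rfl
    exact this

theorem Types.pushoutStable {Z A B D : Type u} {f : Z ⟶ A} {g : Z ⟶ B} {h : A ⟶ D}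
    {k : B ⟶ D} (sq : IsPushout f g h k) : PushoutStable f g h k := by
  intro Z' A' B' D' f' g' h' k' αZ αA αB αD hf hg hh hk w
  have hsurj : ∀ d' : D', (∃ a', h' a' = d') ∨ ∃ b', k' b' = d' := by
    intro d'
    obtain ⟨a, ha⟩ | ⟨b, hb⟩ := Types.eq_or_eq_of_isPushout sq (αD d')
    · obtain ⟨a', ha', -⟩ := Types.exists_of_isPullback hh d' a ha.symm
      exact Or.inl ⟨a', ha'⟩
    · obtain ⟨b', hb', -⟩ := Types.exists_of_isPullback hk d' b hb.symm
      exact Or.inr ⟨b', hb'⟩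
  have hex : ∀ s : PushoutCocone f' g', ∃ d : D' ⟶ s.pt, h' ≫ d = s.inl ∧ k' ≫ d = s.inr := by
    intro s
    let φ : A ⟶ Set (D' × s.pt) := ↾fun a => {p | ∃ a', αA a' = a ∧ h' a' = p.1 ∧ s.inl a' = p.2}
    let ψ : B ⟶ Set (D' × s.pt) := ↾fun b => {p | ∃ b', αB b' = b ∧ k' b' = p.1 ∧ s.inr b' = p.2}
    have hφψ : f ≫ φ = g ≫ ψ := by
      ext z ⟨d', x⟩
      constructor
      · rintro ⟨a', h₁, h₂, h₃⟩
        obtain ⟨z', rfl, rfl⟩ := Types.exists_of_isPullback hf a' z h₁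
        exact ⟨g' z', congr($hg.w z'), congr($w z').symm.trans h₂,
          congr($s.condition z').symm.trans h₃⟩
      · rintro ⟨b', h₁, h₂, h₃⟩
        obtain ⟨z', rfl, rfl⟩ := Types.exists_of_isPullback hg b' z h₁
        exact ⟨f' z', congr($hf.w z'), congr($w z').trans h₂, congr($s.condition z').trans h₃⟩
    let χ := sq.desc φ ψ hφψ
    have hχA : ∀ a' x, (h' a', x) ∈ χ (αD (h' a')) ↔ x = s.inl a' := by
      intro a' x
      have e₁ : αD (h' a') = h (αA a') := congr($hh.w a')
      have e₂ : χ (h (αA a')) = φ (αA a') := congr($(sq.inl_desc φ ψ hφψ) (αA a'))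
      rw [e₁, e₂]
      constructor
      · rintro ⟨a, h₁, h₂, h₃⟩
        obtain rfl := Types.ext_of_isPullback hh h₂ h₁
        exact h₃.symm
      · rintro rfl
        exact ⟨a', rfl, rfl, rfl⟩
    have hχB : ∀ b' x, (k' b', x) ∈ χ (αD (k' b')) ↔ x = s.inr b' := by
      intro b' x
      have e₁ : αD (k' b') = k (αB b') := congr($hk.w b')
      have e₂ : χ (k (αB b')) = ψ (αB b') := congr($(sq.inr_desc φ ψ hφψ) (αB b'))
      rw [e₁, e₂]
      constructor
      · rintro ⟨b, h₁, h₂, h₃⟩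
        obtain rfl := Types.ext_of_isPullback hk h₂ h₁
        exact h₃.symm
      · rintro rfl
        exact ⟨b', rfl, rfl, rfl⟩
    have hχ : ∀ d', ∃ x, (d', x) ∈ χ (αD d') := by
      intro d'
      obtain ⟨a', rfl⟩ | ⟨b', rfl⟩ := hsurj d'
      · exact ⟨_, (hχA a' _).2 rfl⟩
      · exact ⟨_, (hχB b' _).2 rfl⟩
    choose d hd using hχ
    exact ⟨↾d, by ext a'; exact (hχA a' _).1 (hd _), by ext b'; exact (hχB b' _).1 (hd _)⟩
  choose d hd using hex
  refine ⟨⟨w⟩, ⟨PushoutCocone.IsColimit.mk _ d (fun s => (hd s).1) (fun s => (hd s).2) ?_⟩⟩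
  intro s m h₁ h₂
  ext d'
  obtain ⟨a', rfl⟩ | ⟨b', rfl⟩ := hsurj d'
  · exact congr($h₁ a').trans congr($((hd s).1) a').symm
  · exact congr($h₂ b').trans congr($((hd s).2) b').symm

theorem Types.diexact : Diexact (Type u) := fun _ _ _ f g hfg =>
  ⟨⟨_, _, _, IsPushout.of_hasPushout f g⟩, fun _ _ _ sq =>
    ⟨Types.pushoutStable sq, Types.isPullback_of_isMalcevSpan hfg sq⟩⟩

theorem Diexact.functorCategory {K : Type*} [Category* K] {E : Type*} [Category* E]
    [HasFiniteLimits E] [HasPushouts E] (hE : Diexact E) : Diexact (K ⥤ E) := by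
  intro Z A B f g hfg
  refine ⟨⟨_, _, _, IsPushout.of_hasPushout f g⟩, fun D h k sq => ?_⟩
  have H X := (hE _ _ (hfg.map ((evaluation K E).obj X))).2 _ _ (sq.app X)
  refine ⟨fun Z' A' B' D' f' g' h' k' αZ αA αB αD hf hg hh hk w => ?_, ?_⟩
  · exact IsPushout.of_forall_isPushout_app fun X => (H X).1 _ _ _ _ _ _ _ _ (hf.app X)
      (hg.app X) (hh.app X) (hk.app X) congr(($w).app X)
  · exact IsPullback.of_forall_isPullback_app fun X => (H X).2

theorem Diexact.of_adjunction {E : Type*} [Category* E] {S : Type*} [Category* S]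
    [HasFiniteLimits E] [HasFiniteLimits S] {L : E ⥤ S} {U : S ⥤ E} (adj : L ⊣ U) [U.Full]
    [U.Faithful] [PreservesFiniteLimits L] (hE : Diexact E) : Diexact S := by
  have := adj.leftAdjoint_preservesColimits
  have := adj.rightAdjoint_preservesLimits
  let ε : ∀ X : S, L.obj (U.obj X) ≅ X := fun X => asIso (adj.counit.app X)
  have hε : ∀ {X Y : S} (f : X ⟶ Y), L.map (U.map f) ≫ (ε Y).hom = (ε X).hom ≫ f :=
    fun f => adj.counit_naturality f
  have reflect_pushout {Z A B D : S} {f : Z ⟶ A} {g : Z ⟶ B} {h : A ⟶ D} {k : B ⟶ D} {Q : E}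
      {a : U.obj A ⟶ Q} {b : U.obj B ⟶ Q} (hQ : IsPushout (U.map f) (U.map g) a b)
      (d : Q ⟶ U.obj D) (ha : a ≫ d = U.map h) (hb : b ≫ d = U.map k) (hd : IsIso (L.map d)) :
      IsPushout f g h k :=
    (hQ.map L).of_iso (ε Z) (ε A) (ε B) (asIso (L.map d) ≪≫ ε D) (hε f) (hε g)
      (by simp [← hε, ← ha]) (by simp [← hε, ← hb])
  have reflect_pullback {Z A B D : S} {f : Z ⟶ A} {g : Z ⟶ B} {h : A ⟶ D} {k : B ⟶ D} {Q : E}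
      {a : U.obj A ⟶ Q} {b : U.obj B ⟶ Q} (hQ : IsPullback (U.map f) (U.map g) a b)
      (d : Q ⟶ U.obj D) (ha : a ≫ d = U.map h) (hb : b ≫ d = U.map k) (hd : IsIso (L.map d)) :
      IsPullback f g h k :=
    (hQ.map L).of_iso (ε Z) (ε A) (ε B) (asIso (L.map d) ≪≫ ε D) (hε f) (hε g)
      (by simp [← hε, ← ha]) (by simp [← hε, ← hb])
  intro Z A B f g hfg
  obtain ⟨⟨Q, a, b, hQ⟩, hQ'⟩ := hE _ _ (hfg.map U)
  have hLQ := hQ.map L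
  refine ⟨⟨L.obj Q, (ε A).inv ≫ L.map a, (ε B).inv ≫ L.map b,
    hLQ.of_iso (ε Z) (ε A) (ε B) (Iso.refl _) (hε f) (hε g) (by simp) (by simp)⟩,
    fun D h k sq => ?_⟩
  let c : Q ⟶ U.obj D := hQ.desc (U.map h) (U.map k) (by simp only [← U.map_comp, sq.w])
  have hac : a ≫ c = U.map h := hQ.inl_desc _ _ _
  have hbc : b ≫ c = U.map k := hQ.inr_desc _ _ _
  have hLc : IsIso (L.map c) := by
    have sq' : IsPushout (L.map (U.map f)) (L.map (U.map g)) (L.map (U.map h))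
        (L.map (U.map k)) :=
      sq.of_iso' (ε Z) (ε A) (ε B) (ε D) (hε f).symm (hε g).symm (hε h).symm (hε k).symm
    have : L.map c = (hLQ.isoIsPushout _ _ sq').hom :=
      hLQ.hom_ext (by simp [← L.map_comp, hac]) (by simp [← L.map_comp, hbc])
    rw [this]
    infer_instance
  obtain ⟨stable, isPullback⟩ := hQ' a b hQ
  refine ⟨fun Z' A' B' D' f' g' h' k' αZ αA αB αD hf hg hh hk w => ?_,
    reflect_pullback isPullback c hac hbc hLc⟩
  have t := (IsPullback.of_hasPullback (U.map αD) c)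
  have hh' : IsPullback (U.map h') (U.map αA) (U.map αD) (a ≫ c) := by
    simpa only [hac] using hh.map U
  have hk' : IsPullback (U.map k') (U.map αB) (U.map αD) (b ≫ c) := by
    simpa only [hbc] using hk.map U
  refine reflect_pushout (stable _ _ _ _ _ _ _ _ (hf.map U) (hg.map U) (.of_right' hh' t)
    (.of_right' hk' t) (t.hom_ext ?_ ?_)) (pullback.fst _ _) (t.lift_fst _ _ _)
    (t.lift_fst _ _ _) ?_
  · simp only [Category.assoc, IsPullback.lift_fst, ← U.map_comp, w]
  · simp only [Category.assoc, IsPullback.lift_snd, ← U.map_comp_assoc, hf.w, hg.w]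
    simp only [U.map_comp, Category.assoc, hQ.w]
  · exact (t.map L).isIso_fst_of_isIso

theorem Diexact.of_map {C : Type*} [Category* C] [HasFiniteLimits C] {E : Type*} [Category* E]
    [HasPullbacks E] (hE : Diexact E) (F : C ⥤ E) [F.Full] [F.Faithful]
    [PreservesFiniteLimits F]
    (hpo : ∀ ⦃Z A B : C⦄ (f : Z ⟶ A) (g : Z ⟶ B), IsMalcevSpan f g →
      ∃ (D : C) (h : A ⟶ D) (k : B ⟶ D), IsPushout f g h k)
    (hF : ∀ ⦃Z A B P : C⦄ (f : Z ⟶ A) (g : Z ⟶ B) (h : A ⟶ P) (k : B ⟶ P),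
      IsMalcevSpan f g → IsPushout f g h k →
      IsPushout (F.map f) (F.map g) (F.map h) (F.map k)) : Diexact C := by
  refine fun Z A B f g hfg => ⟨hpo f g hfg, fun D h k sq => ?_⟩
  obtain ⟨stable, isPullback⟩ := (hE _ _ (hfg.map F)).2 _ _ (hF f g h k hfg sq)
  refine ⟨fun Z' A' B' D' f' g' h' k' αZ αA αB αD hf hg hh hk w => ?_, .of_map F sq.w isPullback⟩
  exact .of_map F w (stable _ _ _ _ _ _ _ _ (hf.map F) (hg.map F) (hh.map F) (hk.map F)
    (by simp only [← F.map_comp, w]))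

theorem Diexact.sheaf {D : Type u} [SmallCategory D] (J : GrothendieckTopology D) :
    Diexact (Sheaf J (Type u)) :=
  Diexact.of_adjunction (sheafificationAdjunction J (Type u))
    (Diexact.functorCategory Types.diexact.{u})

end Topos

/-- A small, finitely complete category admitting pushouts of Mal'cev
spans is diexact if and only if it admits a fully faithful functor into a Grothendieck
topos (a category of sheaves of sets on a small site) preserving finite limits and
pushouts of Mal'cev spans. -/
theorem diexact_iff_embeds_in_topos {C : Type u} [SmallCategory C] [HasFiniteLimits C]
    (hpo : ∀ ⦃Z A B : C⦄ (f : Z ⟶ A) (g : Z ⟶ B), IsMalcevSpan f g →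
      ∃ (D : C) (h : A ⟶ D) (k : B ⟶ D), IsPushout f g h k) :
    Diexact C ↔
      ∃ (D : Type u) (_ : SmallCategory D) (J : GrothendieckTopology D)
        (F : C ⥤ Sheaf J (Type u)),
        F.Full ∧ F.Faithful ∧ PreservesFiniteLimits F ∧
        ∀ ⦃Z A B P : C⦄ (f : Z ⟶ A) (g : Z ⟶ B) (h : A ⟶ P) (k : B ⟶ P),
          IsMalcevSpan f g → IsPushout f g h k →
          IsPushout (F.map f) (F.map g) (F.map h) (F.map k) := by
  refine ⟨fun hC => ⟨C, inferInstance, Sheaf.canonicalTopology C,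
    (Sheaf.canonicalTopology C).yoneda, inferInstance, inferInstance, inferInstance,
    fun Z A B P f g h k hfg sq => hC.isPushout_yoneda hfg sq⟩, ?_⟩
  rintro ⟨D, _, J, F, _, _, _, hF⟩
  exact (Diexact.sheaf J).of_map F hpo hF
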